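/- Orthogonal vanishing in the sign-product expectation: Let u, x ∈ ℝ^n with u a unit vector and ⟨u, x⟩ = 0. If a and b are independent standard Gaussian random vectors in ℝ^n, then E[ sign((⟨a,u⟩)^2 − (⟨b,u⟩)^2) · ((⟨a,x⟩)^2 − (⟨b,x⟩)^2) ] = 0. -/

import Mathlib

open MeasureTheory ProbabilityTheory Real

lemma aux_coord {Ω : Type*} [MeasureSpace Ω] [IsProbabilityMeasure (ℙ : Measure Ω)]
    {n : ℕ} (a : Ω → Fin n → ℝ)
    (ha : Measure.map a ℙ = Measure.pi fun _ : Fin n => gaussianReal 0 1) :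
    AEMeasurable a ℙ ∧ (∀ j, Measure.map (fun ω => a ω j) ℙ = gaussianReal 0 1) ∧
      iIndepFun (fun j ω => a ω j) ℙ := by
  have hm : AEMeasurable a ℙ := by
    apply AEMeasurable.of_map_ne_zero
    rw [ha]
    exact IsProbabilityMeasure.ne_zero _
  have hc : ∀ j, Measure.map (fun ω => a ω j) ℙ = gaussianReal 0 1 := by
    intro j
    have h := (measurePreserving_eval (fun _ : Fin n => gaussianReal 0 1) j).map_eq
    rw [← ha, AEMeasurable.map_map_of_aemeasurable (measurable_pi_apply j).aemeasurable hm] at h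
    exact h
  refine ⟨hm, hc, ?_⟩
  have hmj : ∀ j, AEMeasurable (fun ω => a ω j) ℙ :=
    fun j => (measurable_pi_apply j).comp_aemeasurable hm
  rw [iIndepFun_iff_map_fun_eq_pi_map hmj]
  simp_rw [hc]
  exact ha

lemma aux_gauss {Ω : Type*} [MeasureSpace Ω] [IsProbabilityMeasure (ℙ : Measure Ω)]
    {n : ℕ} (a : Ω → Fin n → ℝ)
    (ha : Measure.map a ℙ = Measure.pi fun _ : Fin n => gaussianReal 0 1) :
    HasGaussianLaw a ℙ := by
  obtain ⟨hm, hc, hi⟩ := aux_coord a ha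
  exact hi.hasGaussianLaw (fun j => ⟨by rw [hc j]; infer_instance⟩)

lemma aux_cov {Ω : Type*} [MeasureSpace Ω] [IsProbabilityMeasure (ℙ : Measure Ω)]
    {n : ℕ} (u x : Fin n → ℝ) (a : Ω → Fin n → ℝ)
    (ha : Measure.map a ℙ = Measure.pi fun _ : Fin n => gaussianReal 0 1) :
    cov[fun ω => ∑ j, a ω j * u j, fun ω => ∑ j, a ω j * x j; ℙ] = ∑ j, u j * x j := by
  obtain ⟨hm, hc, hi⟩ := aux_coord a ha
  have hg : ∀ j, HasGaussianLaw (fun ω => a ω j) ℙ :=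
    fun j => ⟨by rw [hc j]; infer_instance⟩
  have hL : ∀ j, MemLp (fun ω => a ω j) 2 ℙ := fun j => (hg j).memLp_two
  rw [covariance_fun_sum_fun_sum (fun j => (hL j).mul_const _) (fun j => (hL j).mul_const _)]
  refine Finset.sum_congr rfl fun i _ => ?_
  rw [Finset.sum_eq_single i]
  · rw [covariance_mul_const_left, covariance_mul_const_right,
      covariance_self (hg i).aemeasurable]
    have : Var[fun ω => a ω i; ℙ] = 1 := by
      have h := variance_id_map (hg i).aemeasurable
      rw [hc i, variance_id_gaussianReal] at h
      simpa using h.symm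
    rw [this]; ring
  · intro j _ hj
    rw [covariance_mul_const_left, covariance_mul_const_right,
      (hi.indepFun hj.symm).covariance_eq_zero (hL i) (hL j)]
    simp
  · simp

lemma aux_sign : Measurable Real.sign := by
  unfold Real.sign
  exact Measurable.ite measurableSet_Iio measurable_const
    (Measurable.ite measurableSet_Ioi measurable_const measurable_const)

/-- The functional `v ↦ ∑ v j * y j`. -/
noncomputable def auxL {n : ℕ} (y : Fin n → ℝ) : (Fin n → ℝ) →L[ℝ] ℝ :=
  ∑ j, (y j) • ContinuousLinearMap.proj (R := ℝ) (φ := fun _ : Fin n => ℝ) j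

lemma auxL_apply {n : ℕ} (y v : Fin n → ℝ) : auxL y v = ∑ j, v j * y j := by
  simp [auxL, mul_comm]

/-- Orthogonal vanishing in the sign-product expectation: for a unit vector `u ∈ ℝⁿ`,
`x ∈ ℝⁿ` with `⟨u,x⟩ = 0`, and `a, b` independent standard Gaussian random vectors,
`E[sign(⟨a,u⟩² − ⟨b,u⟩²) · (⟨a,x⟩² − ⟨b,x⟩²)] = 0`. -/
theorem sign_product_expectation_orthogonal
    {Ω : Type*} [MeasureSpace Ω] [IsProbabilityMeasure (ℙ : Measure Ω)]
    {n : ℕ} (u x : Fin n → ℝ) (hu : ∑ j, u j ^ 2 = 1)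
    (hux : ∑ j, u j * x j = 0)
    (a b : Ω → Fin n → ℝ)
    (hab : IndepFun a b ℙ)
    (ha : Measure.map a ℙ = Measure.pi fun _ : Fin n => gaussianReal 0 1)
    (hb : Measure.map b ℙ = Measure.pi fun _ : Fin n => gaussianReal 0 1) :
    ∫ ω, Real.sign ((∑ j, a ω j * u j) ^ 2 - (∑ j, b ω j * u j) ^ 2)
          * ((∑ j, a ω j * x j) ^ 2 - (∑ j, b ω j * x j) ^ 2) ∂ℙ = 0 := by
  have hga := aux_gauss a ha
  have hgb := aux_gauss b hb
  have hG := hab.hasGaussianLaw hga hgb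
  have hla : ∀ y : Fin n → ℝ, HasGaussianLaw (fun ω => ∑ j, a ω j * y j) ℙ := fun y => by
    simpa only [auxL_apply] using hga.map_fun (auxL y)
  have hlb : ∀ y : Fin n → ℝ, HasGaussianLaw (fun ω => ∑ j, b ω j * y j) ℙ := fun y => by
    simpa only [auxL_apply] using hgb.map_fun (auxL y)
  have hcross : ∀ y z : Fin n → ℝ,
      IndepFun (fun ω => ∑ j, a ω j * y j) (fun ω => ∑ j, b ω j * z j) ℙ := fun y z => by
    simpa only [auxL_apply, Function.comp_def] using
      hab.comp (auxL y).continuous.measurable (auxL z).continuous.measurable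
  let X : Fin 2 → Ω → ℝ := ![fun ω => ∑ j, a ω j * u j, fun ω => ∑ j, b ω j * u j]
  let Y : Fin 2 → Ω → ℝ := ![fun ω => ∑ j, a ω j * x j, fun ω => ∑ j, b ω j * x j]
  have hXY : HasGaussianLaw (fun ω => (fun i => X i ω, fun i => Y i ω)) ℙ := by
    let F : (Fin n → ℝ) → (((Fin n → ℝ) × (Fin n → ℝ)) →L[ℝ] (Fin 2 → ℝ)) := fun y =>
      ContinuousLinearMap.pi
        ![(auxL y).comp (ContinuousLinearMap.fst ℝ _ _),
          (auxL y).comp (ContinuousLinearMap.snd ℝ _ _)]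
    convert! hG.map_fun ((F u).prod (F x)) using 1
    funext ω
    refine Prod.ext ?_ ?_ <;> funext i <;> fin_cases i <;> simp [F, X, Y, auxL_apply]
  have hI := hXY.indepFun_of_covariance_eval (by
    intro i j
    fin_cases i <;> fin_cases j
    · exact (aux_cov u x a ha).trans hux
    · exact (hcross u x).covariance_eq_zero (hla u).memLp_two (hlb x).memLp_two
    · exact (hcross x u).symm.covariance_eq_zero (hlb u).memLp_two (hla x).memLp_two
    · exact (aux_cov u x b hb).trans hux)
  have hf : Measurable (fun v : Fin 2 → ℝ => Real.sign (v 0 ^ 2 - v 1 ^ 2)) :=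
    aux_sign.comp (by fun_prop)
  have hg : Measurable (fun v : Fin 2 → ℝ => v 0 ^ 2 - v 1 ^ 2) := by fun_prop
  have key := (hI.comp hf hg).integral_mul_eq_mul_integral
    (hf.comp_aemeasurable hXY.fst.aemeasurable).aestronglyMeasurable
    (hg.comp_aemeasurable hXY.snd.aemeasurable).aestronglyMeasurable
  have hsq : ∫ ω, ((∑ j, a ω j * x j) ^ 2 - (∑ j, b ω j * x j) ^ 2) ∂ℙ = 0 := by
    rw [integral_sub (hla x).memLp_two.integrable_sq (hlb x).memLp_two.integrable_sq]
    have hq : Measurable (fun v : Fin n → ℝ => (∑ j, v j * x j) ^ 2) := by fun_prop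
    have h1 := integral_map hga.aemeasurable hq.aestronglyMeasurable
    have h2 := integral_map hgb.aemeasurable hq.aestronglyMeasurable
    rw [ha] at h1
    rw [hb] at h2
    rw [← h1, ← h2, sub_self]
  refine Eq.trans ?_ (key.trans ?_)
  · rfl
  · refine mul_eq_zero_of_right _ ?_
    exact hsq
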